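/- arXiv:1011.4617 — 3 statements merged into one kernel-verified Lean document; each statement's English description precedes it below -/
import Mathlib

section
/- There exist a universal constant C > 0 and, for each q ∈ [1,2), a constant C_q > 0 depending only on q, such that the following holds. Let ℓ₁, ℓ₂ ∈ [√(2π)/2, 3√(2π)/2], let ℛ = (−ℓ₁/2, ℓ₁/2) × (−ℓ₂/2, ℓ₂/2) be the rectangle of barycenter 0 with these sidelengths, and let m = 2π/(ℓ₁ℓ₂) (so that m|ℛ| = 2π). Let f : cl(ℛ) ∖ {0} → ℝ be such that x ↦ f(x) + log|x| extends to a C¹ function on cl(ℛ), f is C² on ℛ ∖ {0} with Δf = m there, and the outward normal derivative ∇f(x)·ν(x) vanishes at every boundary point x of ℛ other than the four corners. Then: (i) the limit lim_{η→0⁺} ( ∫_{ℛ ∖ B(0,η)} |∇f|² + 2π log η ) exists and its absolute value is at most C; (ii) for every q ∈ [1,2), ∫_ℛ |∇f|^q ≤ C_q. -/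
open MeasureTheory Metric Filter

/-- The Euclidean plane. -/
abbrev E2 : Type := EuclideanSpace ℝ (Fin 2)

/-- The open rectangle of barycenter `0` with sidelengths `l₁, l₂`. -/
def rect (l₁ l₂ : ℝ) : Set E2 := {x | |x 0| < l₁ / 2 ∧ |x 1| < l₂ / 2}

/-- The four corners of the rectangle `rect l₁ l₂`. -/
def corners (l₁ l₂ : ℝ) : Set E2 :=
  {x | (x 0 = l₁ / 2 ∨ x 0 = -(l₁ / 2)) ∧ (x 1 = l₂ / 2 ∨ x 1 = -(l₂ / 2))}

/-- The Laplacian of `f : ℝ² → ℝ` (as an iterated directional derivative). -/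
noncomputable def lap (f : E2 → ℝ) (x : E2) : ℝ :=
  fderiv ℝ (fun y => fderiv ℝ f y (EuclideanSpace.single 0 1)) x (EuclideanSpace.single 0 1) +
  fderiv ℝ (fun y => fderiv ℝ f y (EuclideanSpace.single 1 1)) x (EuclideanSpace.single 1 1)

/-- `f` is a solution of the Neumann single-vortex problem
`−Δf = 2πδ₀ − m` in `ℛ = rect l₁ l₂` (with `m = 2π/(l₁l₂)`), `∂f/∂ν = 0` on `∂ℛ`:
`f + log|·|` extends to a `C¹` function on `cl(ℛ)`, `f` is `C²` on `ℛ∖{0}` with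
`Δf = m` there, and the normal derivative vanishes on the boundary away from the
corners. -/
def GoodF (l₁ l₂ : ℝ) (f : E2 → ℝ) : Prop :=
  (∃ S : E2 → ℝ, ContDiffOn ℝ 1 S (closure (rect l₁ l₂)) ∧
    ∀ x ∈ closure (rect l₁ l₂), x ≠ 0 → f x = S x - Real.log ‖x‖) ∧
  ContDiffOn ℝ 2 f (rect l₁ l₂ \ {0}) ∧
  (∀ x ∈ rect l₁ l₂ \ {0}, lap f x = 2 * Real.pi / (l₁ * l₂)) ∧
  (∀ x ∈ frontier (rect l₁ l₂), x ∉ corners l₁ l₂ →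
    ((x 0 = l₁ / 2 ∨ x 0 = -(l₁ / 2)) →
      fderivWithin ℝ f (closure (rect l₁ l₂)) x (EuclideanSpace.single 0 1) = 0) ∧
    ((x 1 = l₂ / 2 ∨ x 1 = -(l₂ / 2)) →
      fderivWithin ℝ f (closure (rect l₁ l₂)) x (EuclideanSpace.single 1 1) = 0))

local notation "e₀" => (EuclideanSpace.single 0 1 : E2)
local notation "e₁" => (EuclideanSpace.single 1 1 : E2)

/-- The closed rectangle of barycenter `0` with sidelengths `l₁, l₂`. -/
def closedRect (l₁ l₂ : ℝ) : Set E2 := {x | |x 0| ≤ l₁ / 2 ∧ |x 1| ≤ l₂ / 2}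

lemma rect_subset_closedRect (l₁ l₂ : ℝ) : rect l₁ l₂ ⊆ closedRect l₁ l₂ :=
  fun _ hx => ⟨hx.1.le, hx.2.le⟩

lemma isOpen_rect (l₁ l₂ : ℝ) : IsOpen (rect l₁ l₂) :=
  (isOpen_lt (f := fun x : E2 => |x 0|) (by fun_prop) continuous_const).inter
    (isOpen_lt (f := fun x : E2 => |x 1|) (by fun_prop) continuous_const)

lemma isClosed_closedRect (l₁ l₂ : ℝ) : IsClosed (closedRect l₁ l₂) :=
  (isClosed_le (f := fun x : E2 => |x 0|) (by fun_prop) continuous_const).inter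
    (isClosed_le (f := fun x : E2 => |x 1|) (by fun_prop) continuous_const)

lemma norm_sq_eq_coords (x : E2) : ‖x‖ ^ 2 = x 0 ^ 2 + x 1 ^ 2 := by
  rw [EuclideanSpace.real_norm_sq_eq, Fin.sum_univ_two]

lemma convex_rect (l₁ l₂ : ℝ) : Convex ℝ (rect l₁ l₂) := by
  have h : rect l₁ l₂ = (EuclideanSpace.proj (𝕜 := ℝ) (0 : Fin 2)) ⁻¹' (ball 0 (l₁ / 2)) ∩
      (EuclideanSpace.proj (𝕜 := ℝ) (1 : Fin 2)) ⁻¹' (ball 0 (l₂ / 2)) := by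
    ext x; simp [rect]
  rw [h]
  exact ((convex_ball _ _).linear_preimage (EuclideanSpace.proj (𝕜 := ℝ) (0 : Fin 2)).toLinearMap).inter
    ((convex_ball _ _).linear_preimage (EuclideanSpace.proj (𝕜 := ℝ) (1 : Fin 2)).toLinearMap)

lemma closure_rect {l₁ l₂ : ℝ} (h₁ : 0 < l₁) (h₂ : 0 < l₂) :
    closure (rect l₁ l₂) = closedRect l₁ l₂ := by
  let e := (EuclideanSpace.equiv (Fin 2) ℝ).toHomeomorph
  have h : rect l₁ l₂ = e ⁻¹' (Set.univ.pi ![ball 0 (l₁ / 2), ball 0 (l₂ / 2)]) := by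
    ext x; simp [rect, e, Set.mem_pi, Fin.forall_fin_two]
  have h' : closedRect l₁ l₂ =
      e ⁻¹' (Set.univ.pi ![closedBall 0 (l₁ / 2), closedBall 0 (l₂ / 2)]) := by
    ext x; simp [closedRect, e, Set.mem_pi, Fin.forall_fin_two]
  rw [h, h', ← e.preimage_closure, closure_pi_set]
  congr 2
  ext i : 1
  fin_cases i <;> simp [closure_ball, h₁.ne', h₂.ne']

lemma frontier_rect {l₁ l₂ : ℝ} (h₁ : 0 < l₁) (h₂ : 0 < l₂) :
    frontier (rect l₁ l₂) = closedRect l₁ l₂ \ rect l₁ l₂ := by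
  rw [frontier, closure_rect h₁ h₂, (isOpen_rect _ _).interior_eq]

lemma closedRect_subset_ball {l₁ l₂ : ℝ} (h₁ : l₁ ≤ 4) (h₂ : l₂ ≤ 4) :
    closedRect l₁ l₂ ⊆ ball 0 3 := by
  intro x hx
  rw [mem_ball_zero_iff]
  have h := norm_sq_eq_coords x
  have h0 := sq_abs (x 0)
  have h1 := sq_abs (x 1)
  have := hx.1
  have := hx.2
  nlinarith [abs_nonneg (x 0), abs_nonneg (x 1), norm_nonneg x]

lemma isCompact_closedRect (l₁ l₂ : ℝ) : IsCompact (closedRect l₁ l₂) := by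
  rw [Metric.isCompact_iff_isClosed_bounded]
  refine ⟨isClosed_closedRect _ _, isBounded_closedBall (x := (0:E2)) (r := |l₁| + |l₂|) |>.subset ?_⟩
  intro x hx
  rw [mem_closedBall_zero_iff]
  have h := norm_sq_eq_coords x
  have h0 := sq_abs (x 0)
  have h1 := sq_abs (x 1)
  have := hx.1
  have := hx.2
  have := le_abs_self l₁
  have := le_abs_self l₂
  apply le_of_sq_le_sq _ (by positivity)
  nlinarith [abs_nonneg (x 0), abs_nonneg (x 1), norm_nonneg x]

/-- The divergence theorem on a rectangle for a field with vanishing normal component, which is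
continuous up to the boundary and differentiable in the interior except at the origin. -/
lemma integral_divergence_rect_eq_zero {l₁ l₂ : ℝ} (h₁ : 0 < l₁) (h₂ : 0 < l₂)
    {u v : E2 → ℝ} {u' v' : E2 → E2 →L[ℝ] ℝ}
    (hu : ContinuousOn u (closedRect l₁ l₂)) (hv : ContinuousOn v (closedRect l₁ l₂))
    (hu' : ∀ x ∈ rect l₁ l₂ \ {0}, HasFDerivAt u (u' x) x)
    (hv' : ∀ x ∈ rect l₁ l₂ \ {0}, HasFDerivAt v (v' x) x)
    (hi : IntegrableOn (fun x => u' x e₀ + v' x e₁) (rect l₁ l₂))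
    (hu0 : ∀ x ∈ closedRect l₁ l₂, |x 0| = l₁ / 2 → |x 1| < l₂ / 2 → u x = 0)
    (hv0 : ∀ x ∈ closedRect l₁ l₂, |x 1| = l₂ / 2 → |x 0| < l₁ / 2 → v x = 0) :
    ∫ x in rect l₁ l₂, (u' x e₀ + v' x e₁) = 0 := by
  let E : (ℝ × ℝ) ≃L[ℝ] E2 := (ContinuousLinearEquiv.finTwoArrow ℝ ℝ).symm.trans
    (EuclideanSpace.equiv (Fin 2) ℝ).symm
  have hE0 : ∀ p, E p 0 = p.1 := fun p => rfl
  have hE1 : ∀ p, E p 1 = p.2 := fun p => rfl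
  have hEp : MeasurePreserving E :=
    (PiLp.volume_preserving_toLp (Fin 2)).comp ((volume_preserving_finTwoArrow ℝ).symm _)
  have hEm : MeasurableEmbedding E := E.toHomeomorph.measurableEmbedding
  have ha : E (1, 0) = e₀ := by ext i; fin_cases i <;> simp [hE0, hE1]
  have hb : E (0, 1) = e₁ := by ext i; fin_cases i <;> simp [hE0, hE1]
  let a : ℝ × ℝ := (-(l₁ / 2), -(l₂ / 2))
  let b : ℝ × ℝ := (l₁ / 2, l₂ / 2)
  have hpc : E ⁻¹' closedRect l₁ l₂ = Set.Icc a b := by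
    ext p
    simp only [Set.mem_preimage, closedRect, Set.mem_ofPred_eq, hE0, hE1, abs_le, Set.mem_Icc,
      Prod.le_def, a, b]
    tauto
  have hpo : E ⁻¹' rect l₁ l₂ = Set.Ioo a.1 b.1 ×ˢ Set.Ioo a.2 b.2 := by
    ext p
    simp [rect, hE0, hE1, abs_lt, a, b]
  have hmap : Set.MapsTo E (Set.Icc a b) (closedRect l₁ l₂) := by
    rw [← hpc]; exact Set.mapsTo_preimage _ _
  have hle : a ≤ b := ⟨by simp [a, b]; linarith, by simp [a, b]; linarith⟩
  have hae : (Set.Ioo a.1 b.1 ×ˢ Set.Ioo a.2 b.2 : Set (ℝ × ℝ)) =ᵐ[volume] Set.Icc a b := by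
    have : Set.Icc a b = Set.Icc a.1 b.1 ×ˢ Set.Icc a.2 b.2 := (Set.Icc_prod_eq _ _)
    rw [this]
    exact Measure.set_prod_ae_eq Ioo_ae_eq_Icc Ioo_ae_eq_Icc
  have key := integral_divergence_prod_Icc_of_hasFDerivAt_off_countable_of_le
    (u ∘ E) (v ∘ E) (fun p => (u' (E p)).comp (E : ℝ × ℝ →L[ℝ] E2))
    (fun p => (v' (E p)).comp (E : ℝ × ℝ →L[ℝ] E2)) a b hle {0} (Set.countable_singleton _)
    (hu.comp E.continuous.continuousOn hmap) (hv.comp E.continuous.continuousOn hmap)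
    (fun p hp => (hu' (E p) ⟨by rw [← Set.mem_preimage, hpo]; exact hp.1,
      by simpa using hp.2⟩).comp p E.hasFDerivAt)
    (fun p hp => (hv' (E p) ⟨by rw [← Set.mem_preimage, hpo]; exact hp.1,
      by simpa using hp.2⟩).comp p E.hasFDerivAt)
    (by
      have := (hEp.integrableOn_comp_preimage hEm).2 hi
      rw [hpo, integrableOn_congr_set_ae hae] at this
      simpa [ha, hb, Function.comp_def] using this)
  have hz : ∀ (g : ℝ → ℝ) (c : ℝ), (∀ t ∈ Set.Ioo (-c) c, g t = 0) → 0 < c →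
      ∫ t in (-c)..c, g t = 0 := by
    intro g c hg hc
    rw [intervalIntegral.integral_of_le (by linarith), integral_Ioc_eq_integral_Ioo]
    exact setIntegral_eq_zero_of_forall_eq_zero hg
  have hl : ∫ x in rect l₁ l₂, (u' x e₀ + v' x e₁) =
      ∫ p in Set.Icc a b, (u' (E p) (E (1, 0)) + v' (E p) (E (0, 1))) := by
    rw [ha, hb, ← hEp.setIntegral_preimage_emb hEm, hpo]
    exact setIntegral_congr_set hae
  rw [hl]
  simp only [ContinuousLinearMap.comp_apply, ContinuousLinearEquiv.coe_coe, Function.comp_apply] at key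
  rw [key]
  have abs1 : |l₁ / 2| = l₁ / 2 := abs_of_pos (by linarith)
  have abs2 : |l₂ / 2| = l₂ / 2 := abs_of_pos (by linarith)
  rw [hz _ _ _ (by simp; linarith), hz _ _ _ (by simp; linarith),
    hz _ _ _ (by simp; linarith), hz _ _ _ (by simp; linarith)]
  · ring
  all_goals
    intro t ht
    replace ht := abs_lt.2 ht
    first
    | exact hv0 _ (by simp [closedRect, hE0, hE1, abs2, a, b]; exact ht.le)
        (by simp [hE1, a, b, abs2]) ht
    | exact hu0 _ (by simp [closedRect, hE0, hE1, abs1, a, b]; exact ht.le)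
        (by simp [hE0, a, b, abs1]) ht

/-- The plane field `W` has divergence `d` at `x`. -/
def HasDivAt (W : E2 → E2) (d : ℝ) (x : E2) : Prop :=
  ∃ A B : E2 →L[ℝ] ℝ, HasFDerivAt (fun y => W y 0) A x ∧ HasFDerivAt (fun y => W y 1) B x ∧
    A e₀ + B e₁ = d

lemma HasDivAt.sub {V W : E2 → E2} {c d : ℝ} {x : E2} (hV : HasDivAt V c x)
    (hW : HasDivAt W d x) : HasDivAt (fun y => V y - W y) (c - d) x := by
  obtain ⟨A, B, hA, hB, rfl⟩ := hV
  obtain ⟨A', B', hA', hB', rfl⟩ := hW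
  exact ⟨A - A', B - B', hA.sub hA', hB.sub hB', by simp; ring⟩

lemma HasDivAt.smul {W : E2 → E2} {φ : E2 → ℝ} {d : ℝ} {x g : E2} (hφ : HasGradientAt φ g x)
    (hW : HasDivAt W d x) : HasDivAt (fun y => φ y • W y) (φ x * d + inner ℝ g (W x)) x := by
  obtain ⟨A, B, hA, hB, rfl⟩ := hW
  refine ⟨_, _, hφ.hasFDerivAt.mul hA, hφ.hasFDerivAt.mul hB, ?_⟩
  simp [PiLp.inner_apply, Fin.sum_univ_two]
  ring

/-- The normal component of `W` vanishes on the sides of the rectangle, corners excluded. -/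
def NormalZero (l₁ l₂ : ℝ) (W : E2 → E2) : Prop :=
  ∀ x ∈ closedRect l₁ l₂, (|x 0| = l₁ / 2 → |x 1| < l₂ / 2 → W x 0 = 0) ∧
    (|x 1| = l₂ / 2 → |x 0| < l₁ / 2 → W x 1 = 0)

lemma ae_restrict_rect_of_ne_zero {l₁ l₂ : ℝ} {p : E2 → Prop}
    (h : ∀ x ∈ rect l₁ l₂ \ {0}, p x) : ∀ᵐ x ∂volume.restrict (rect l₁ l₂), p x := by
  filter_upwards [ae_restrict_mem (isOpen_rect l₁ l₂).measurableSet,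
    ae_restrict_of_ae (Measure.ae_ne volume (0 : E2))] with x hx hx0 using h x ⟨hx, hx0⟩

lemma integral_eq_zero_of_hasDivAt {l₁ l₂ : ℝ} (h₁ : 0 < l₁) (h₂ : 0 < l₂)
    {W : E2 → E2} {d : E2 → ℝ} (hW : ContinuousOn W (closedRect l₁ l₂))
    (hd : ∀ x ∈ rect l₁ l₂ \ {0}, HasDivAt W (d x) x) (hi : IntegrableOn d (rect l₁ l₂))
    (hn : NormalZero l₁ l₂ W) : ∫ x in rect l₁ l₂, d x = 0 := by
  have hW0 : ∀ i, ContinuousOn (fun x => W x i) (closedRect l₁ l₂) := fun i =>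
    (EuclideanSpace.proj (𝕜 := ℝ) i).continuous.comp_continuousOn hW
  have hae : d =ᵐ[volume.restrict (rect l₁ l₂)] fun x =>
      fderiv ℝ (fun y => W y 0) x e₀ + fderiv ℝ (fun y => W y 1) x e₁ := by
    refine ae_restrict_rect_of_ne_zero fun x hx => ?_
    obtain ⟨A, B, hA, hB, h⟩ := hd x hx
    beta_reduce
    rw [hA.fderiv, hB.fderiv, h]
  rw [integral_congr_ae hae]
  refine integral_divergence_rect_eq_zero h₁ h₂ (hW0 0) (hW0 1) (fun x hx => ?_) (fun x hx => ?_)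
    ((integrable_congr hae).1 hi) (fun x hx => (hn x hx).1) (fun x hx => (hn x hx).2)
  · obtain ⟨A, B, hA, hB, h⟩ := hd x hx
    exact hA.differentiableAt.hasFDerivAt
  · obtain ⟨A, B, hA, hB, h⟩ := hd x hx
    exact hB.differentiableAt.hasFDerivAt

/-- A divergence free field with vanishing normal component is orthogonal to gradients. -/
lemma integral_inner_gradient_eq_zero {l₁ l₂ : ℝ} (h₁ : 0 < l₁) (h₂ : 0 < l₂)
    {Q g : E2 → E2} {φ : E2 → ℝ} (hQ : ContinuousOn Q (closedRect l₁ l₂))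
    (hd : ∀ x ∈ rect l₁ l₂ \ {0}, HasDivAt Q 0 x) (hn : NormalZero l₁ l₂ Q)
    (hφ : ContinuousOn φ (closedRect l₁ l₂)) (hg : ContinuousOn g (closedRect l₁ l₂))
    (hgrad : ∀ x ∈ rect l₁ l₂ \ {0}, HasGradientAt φ (g x) x) :
    ∫ x in rect l₁ l₂, inner ℝ (g x) (Q x) = 0 := by
  refine integral_eq_zero_of_hasDivAt h₁ h₂ (hφ.smul hQ) (fun x hx => ?_) ?_ (fun x hx => ?_)
  · have := (hd x hx).smul (hgrad x hx)
    rwa [mul_zero, zero_add] at this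
  · exact ((hg.inner hQ).integrableOn_compact (isCompact_closedRect _ _)).mono_set
      (rect_subset_closedRect _ _)
  · refine ⟨fun h h' => ?_, fun h h' => ?_⟩
    · simp [(hn x hx).1 h h']
    · simp [(hn x hx).2 h h']

lemma HasFDerivAt.apply_eq_of_hasDerivAt {φ : E2 → ℝ} {A : E2 →L[ℝ] ℝ} {x v : E2} {d : ℝ}
    (h : HasFDerivAt φ A x) (hd : HasDerivAt (fun t : ℝ => φ (x + t • v)) d 0) : A v = d :=
  (h.hasLineDerivAt v).unique hd

/-- The fundamental field `x / ‖x‖²`, the gradient of `log ‖x‖`. -/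
noncomputable def logGrad (x : E2) : E2 := (‖x‖ ^ 2)⁻¹ • x

lemma norm_logGrad (x : E2) : ‖logGrad x‖ = ‖x‖⁻¹ := by
  rw [logGrad, norm_smul, norm_inv, norm_pow, norm_norm]
  rcases eq_or_ne ‖x‖ 0 with h | h
  · simp [h]
  · field_simp

lemma hasGradientAt_log_norm {x : E2} (hx : x ≠ 0) :
    HasGradientAt (fun y : E2 => Real.log ‖y‖) (logGrad x) x := by
  have h : (fun y : E2 => Real.log ‖y‖) = fun y => 2⁻¹ * Real.log (‖y‖ ^ 2) := by
    ext y; rw [Real.log_pow]; push_cast; ring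
  rw [h, hasGradientAt_iff_hasFDerivAt]
  refine (((hasStrictFDerivAt_norm_sq x).hasFDerivAt.log
    (pow_ne_zero 2 (norm_ne_zero_iff.2 hx))).const_mul 2⁻¹).congr_fderiv ?_
  ext v
  simp [logGrad]
  ring

lemma hasGradientAt_log_norm_sq_add {ε : ℝ} (hε : 0 < ε) (x : E2) :
    HasGradientAt (fun y : E2 => 2⁻¹ * Real.log (‖y‖ ^ 2 + ε)) ((‖x‖ ^ 2 + ε)⁻¹ • x) x := by
  rw [hasGradientAt_iff_hasFDerivAt]
  refine ((((hasStrictFDerivAt_norm_sq x).hasFDerivAt.add_const ε).log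
    (by positivity)).const_mul 2⁻¹).congr_fderiv ?_
  ext v
  simp
  ring

lemma hasDivAt_logGrad {x : E2} (hx : x ≠ 0) : HasDivAt logGrad 0 x := by
  have hn : x 0 ^ 2 + x 1 ^ 2 ≠ 0 := by
    rw [← norm_sq_eq_coords]; exact pow_ne_zero 2 (norm_ne_zero_iff.2 hx)
  have hfun : ∀ i, (fun y => logGrad y i) = fun y : E2 => y i / (y 0 ^ 2 + y 1 ^ 2) := by
    intro i; ext y; simp [logGrad, norm_sq_eq_coords]; ring
  have hdiff : ∀ i, DifferentiableAt ℝ (fun y => logGrad y i) x := by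
    intro i; rw [hfun]; fun_prop (disch := exact hn)
  refine ⟨_, _, (hdiff 0).hasFDerivAt, (hdiff 1).hasFDerivAt, ?_⟩
  have key : ∀ s c : ℝ, s ^ 2 + c ≠ 0 → HasDerivAt (fun t : ℝ => (s + t) / ((s + t) ^ 2 + c))
      ((c - s ^ 2) / (s ^ 2 + c) ^ 2) 0 := by
    intro s c h
    have h1 : HasDerivAt (fun t : ℝ => s + t) 1 0 := (hasDerivAt_id 0).const_add s
    refine (h1.div ((h1.pow 2).add_const c) (by simpa using h)).congr_deriv ?_
    simp; ring
  rw [(hdiff 0).hasFDerivAt.apply_eq_of_hasDerivAt (d := (x 1 ^ 2 - x 0 ^ 2) / (x 0 ^ 2 + x 1 ^ 2) ^ 2),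
    (hdiff 1).hasFDerivAt.apply_eq_of_hasDerivAt (d := (x 0 ^ 2 - x 1 ^ 2) / (x 1 ^ 2 + x 0 ^ 2) ^ 2)]
  · rw [add_comm (x 1 ^ 2)]; ring
  · simp only [fun y => congrFun (hfun 1) y]
    simpa [add_comm (x 0 ^ 2)] using key (x 1) (x 0 ^ 2) (by rwa [add_comm])
  · simp only [fun y => congrFun (hfun 0) y]
    simpa using key (x 0) (x 1 ^ 2) hn

/-- Profile of the comparison field: a linear interpolation of the flux of `logGrad` through two
opposite sides, corrected by a function of `s` vanishing for `s = ± a`. -/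
noncomputable def fluxProfile (a b s t : ℝ) : ℝ :=
  s / (a ^ 2 + t ^ 2) - (Real.arctan (s / b) - s / a * Real.arctan (a / b)) / b

lemma hasDerivAt_fluxProfile {a b : ℝ} (ha : 0 < a) (hb : 0 < b) (s t : ℝ) :
    HasDerivAt (fun r => fluxProfile a b (s + r) t)
      ((a ^ 2 + t ^ 2)⁻¹ - (b ^ 2 + s ^ 2)⁻¹ + Real.arctan (a / b) / (a * b)) 0 := by
  have h1 : HasDerivAt (fun t : ℝ => s + t) 1 0 := (hasDerivAt_id 0).const_add s
  refine ((h1.div_const (a ^ 2 + t ^ 2)).sub ((((h1.div_const b).arctan).sub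
    ((h1.div_const a).mul_const (Real.arctan (a / b)))).div_const b)).congr_deriv ?_
  simp only [add_zero]
  have : (1 + (s / b) ^ 2) = (b ^ 2 + s ^ 2) / b ^ 2 := by field_simp
  rw [this]
  field_simp
  ring

/-- A bounded field with the same normal component as `logGrad` and constant divergence. -/
noncomputable def fluxField (a b : ℝ) (x : E2) : E2 :=
  !₂[fluxProfile a b (x 0) (x 1), fluxProfile b a (x 1) (x 0)]

lemma differentiable_fluxProfile {a b : ℝ} (ha : 0 < a) (i j : Fin 2) :
    Differentiable ℝ (fun x : E2 => fluxProfile a b (x i) (x j)) := by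
  unfold fluxProfile
  have h : ∀ x : E2, a ^ 2 + x j ^ 2 ≠ 0 := fun x => by positivity
  simp only [div_eq_mul_inv]
  intro x
  have hx := h x
  have hatan : DifferentiableAt ℝ (fun x : E2 => Real.arctan (x i * b⁻¹)) x :=
    DifferentiableAt.arctan (by fun_prop)
  fun_prop (disch := assumption)

lemma continuous_fluxField {a b : ℝ} (ha : 0 < a) (hb : 0 < b) : Continuous (fluxField a b) := by
  refine (PiLp.continuous_toLp 2 _).comp (continuous_pi fun i => ?_)
  fin_cases i
  · exact (differentiable_fluxProfile ha 0 1).continuous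
  · exact (differentiable_fluxProfile hb 1 0).continuous

lemma hasDivAt_fluxField {a b : ℝ} (ha : 0 < a) (hb : 0 < b) (x : E2) :
    HasDivAt (fluxField a b) (Real.pi / (2 * a * b)) x := by
  refine ⟨_, _, (differentiable_fluxProfile ha 0 1 x).hasFDerivAt,
    (differentiable_fluxProfile hb 1 0 x).hasFDerivAt, ?_⟩
  rw [(differentiable_fluxProfile ha 0 1 x).hasFDerivAt.apply_eq_of_hasDerivAt
      (by simpa using hasDerivAt_fluxProfile ha hb (x 0) (x 1)),
    (differentiable_fluxProfile hb 1 0 x).hasFDerivAt.apply_eq_of_hasDerivAt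
      (by simpa using hasDerivAt_fluxProfile hb ha (x 1) (x 0))]
  have h := Real.arctan_inv_of_pos (div_pos ha hb)
  rw [inv_div] at h
  rw [h]
  field_simp
  ring

lemma fluxProfile_of_abs_eq {a b s t : ℝ} (ha : 0 < a) (hs : |s| = a) :
    fluxProfile a b s t = s / (s ^ 2 + t ^ 2) := by
  rcases (abs_eq ha.le).1 hs with rfl | rfl
  · simp [fluxProfile, ha.ne']
  · simp [fluxProfile, neg_div, Real.arctan_neg, div_self ha.ne']

lemma abs_fluxProfile_le {a b s t : ℝ} (ha : 1 / 2 ≤ a) (hb : 1 / 2 ≤ b) (hs : |s| ≤ a) :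
    |fluxProfile a b s t| ≤ 10 := by
  have ha0 : 0 < a := by linarith
  have hb0 : 0 < b := by linarith
  have h1 : |s / (a ^ 2 + t ^ 2)| ≤ 2 := by
    rw [abs_div, abs_of_pos (by positivity : 0 < a ^ 2 + t ^ 2), div_le_iff₀ (by positivity)]
    nlinarith [sq_nonneg t]
  have har : ∀ y, |Real.arctan y| ≤ 2 := fun y => by
    have := Real.pi_lt_four
    exact abs_le.2 ⟨by linarith [Real.neg_pi_div_two_lt_arctan y],
      by linarith [Real.arctan_lt_pi_div_two y]⟩
  have h2 : |s / a * Real.arctan (a / b)| ≤ 2 := by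
    rw [abs_mul, abs_div, abs_of_pos ha0]
    have : |s| / a ≤ 1 := (div_le_one ha0).2 hs
    nlinarith [har (a / b), abs_nonneg (Real.arctan (a / b))]
  have h3 : |(Real.arctan (s / b) - s / a * Real.arctan (a / b)) / b| ≤ 8 := by
    rw [abs_div, abs_of_pos hb0, div_le_iff₀ hb0]
    linarith [abs_sub (Real.arctan (s / b)) (s / a * Real.arctan (a / b)), har (s / b)]
  unfold fluxProfile
  linarith [abs_sub (s / (a ^ 2 + t ^ 2)) ((Real.arctan (s / b) - s / a * Real.arctan (a / b)) / b)]

lemma norm_fluxField_le {l₁ l₂ : ℝ} (h₁ : 1 ≤ l₁) (h₂ : 1 ≤ l₂) {x : E2}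
    (hx : x ∈ closedRect l₁ l₂) : ‖fluxField (l₁ / 2) (l₂ / 2) x‖ ≤ 20 := by
  have h := norm_sq_eq_coords (fluxField (l₁ / 2) (l₂ / 2) x)
  have h0 : |fluxField (l₁ / 2) (l₂ / 2) x 0| ≤ 10 :=
    abs_fluxProfile_le (by linarith) (by linarith) hx.1
  have h1 : |fluxField (l₁ / 2) (l₂ / 2) x 1| ≤ 10 :=
    abs_fluxProfile_le (by linarith) (by linarith) hx.2
  have := sq_le_sq' (abs_le.1 h0).1 (abs_le.1 h0).2
  have := sq_le_sq' (abs_le.1 h1).1 (abs_le.1 h1).2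
  nlinarith [norm_nonneg (fluxField (l₁ / 2) (l₂ / 2) x)]

lemma normalZero_logGrad_sub_fluxField {l₁ l₂ : ℝ} (h₁ : 0 < l₁) (h₂ : 0 < l₂) :
    NormalZero l₁ l₂ (fun x => logGrad x - fluxField (l₁ / 2) (l₂ / 2) x) := by
  intro x _
  refine ⟨fun h _ => ?_, fun h _ => ?_⟩
  · simp [fluxField, fluxProfile_of_abs_eq (half_pos h₁) h, logGrad, norm_sq_eq_coords]
    ring
  · simp [fluxField, fluxProfile_of_abs_eq (half_pos h₂) h, logGrad, norm_sq_eq_coords]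
    ring

lemma uniqueDiffOn_closedRect {l₁ l₂ : ℝ} (h₁ : 0 < l₁) (h₂ : 0 < l₂) :
    UniqueDiffOn ℝ (closedRect l₁ l₂) := by
  rw [← closure_rect h₁ h₂]
  refine uniqueDiffOn_convex (convex_rect l₁ l₂).closure ⟨0, ?_⟩
  exact interior_mono subset_closure (by
    rw [(isOpen_rect l₁ l₂).interior_eq]; simp [rect, h₁, h₂])

lemma GoodF.exists_gradient {l₁ l₂ : ℝ} (h₁ : 0 < l₁) (h₂ : 0 < l₂) {f : E2 → ℝ}
    (hf : GoodF l₁ l₂ f) :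
    ∃ (S : E2 → ℝ) (P : E2 → E2), ContinuousOn S (closedRect l₁ l₂) ∧
      ContinuousOn P (closedRect l₁ l₂) ∧
      (∀ x ∈ rect l₁ l₂, HasGradientAt S (P x) x) ∧
      (∀ x ∈ rect l₁ l₂ \ {0}, HasGradientAt f (P x - logGrad x) x) ∧
      (∀ x ∈ rect l₁ l₂ \ {0}, HasDivAt P (2 * Real.pi / (l₁ * l₂)) x) ∧
      NormalZero l₁ l₂ (fun x => P x - logGrad x) := by
  obtain ⟨⟨S, hS, hfS⟩, hf2, hlap, hbd⟩ := hf
  rw [closure_rect h₁ h₂] at hS hfS hbd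
  have hU := uniqueDiffOn_closedRect h₁ h₂
  set K := closedRect l₁ l₂ with hK
  have hSd : ∀ x ∈ K, HasGradientWithinAt S (gradientWithin S K x) K x := fun x hx =>
    ((hS.differentiableOn one_ne_zero) x hx).hasGradientWithinAt
  have hnhds : ∀ x ∈ rect l₁ l₂, K ∈ nhds x := fun x hx =>
    mem_of_superset ((isOpen_rect _ _).mem_nhds hx) (rect_subset_closedRect _ _)
  have hfd : ∀ x ∈ K, x ≠ 0 → HasGradientWithinAt f (gradientWithin S K x - logGrad x) K x := by
    intro x hx hx0
    have h := (hSd x hx).hasFDerivWithinAt.sub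
      (hasGradientAt_log_norm hx0).hasFDerivAt.hasFDerivWithinAt (s := K)
    rw [← map_sub] at h
    refine HasFDerivWithinAt.congr_of_eventuallyEq (h : HasFDerivWithinAt _ _ K x) ?_ (hfS x hx hx0)
    filter_upwards [self_mem_nhdsWithin, mem_nhdsWithin_of_mem_nhds (isOpen_ne.mem_nhds hx0)]
      with y hy hy0 using hfS y hy hy0
  have hfg : ∀ x ∈ rect l₁ l₂ \ {0}, HasGradientAt f (gradientWithin S K x - logGrad x) x :=
    fun x hx => HasFDerivWithinAt.hasFDerivAt
      (hfd x (rect_subset_closedRect _ _ hx.1) hx.2) (hnhds x hx.1)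
  refine ⟨S, gradientWithin S K, hS.continuousOn, ?_, fun x hx => ?_, hfg, fun x hx => ?_, ?_⟩
  · exact (InnerProductSpace.toDual ℝ E2).symm.continuous.comp_continuousOn
      (hS.continuousOn_fderivWithin hU le_rfl)
  · exact HasFDerivWithinAt.hasFDerivAt (hSd x (rect_subset_closedRect _ _ hx)) (hnhds x hx)
  · have hopen : IsOpen (rect l₁ l₂ \ {0}) := (isOpen_rect _ _).sdiff isClosed_singleton
    have hfx : ContDiffAt ℝ 2 f x := hf2.contDiffAt (hopen.mem_nhds hx)
    have hdiff : ∀ v : E2, DifferentiableAt ℝ (fun y => fderiv ℝ f y v) x := fun v =>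
      ((hfx.fderiv_right (m := 1) (by norm_num)).differentiableAt one_ne_zero).clm_apply
        (differentiableAt_const v)
    obtain ⟨A, B, hA, hB, hAB⟩ := hasDivAt_logGrad (x := x) hx.2
    have heq : ∀ i : Fin 2, (fun y => gradientWithin S K y i) =ᶠ[nhds x]
        fun y => fderiv ℝ f y (EuclideanSpace.single i 1) + logGrad y i := by
      intro i
      filter_upwards [hopen.mem_nhds hx] with y hy
      rw [(hfg y hy).fderiv_apply, EuclideanSpace.inner_single_right]
      simp
    refine ⟨_, _, ((hdiff e₀).hasFDerivAt.add hA).congr_of_eventuallyEq (heq 0),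
      ((hdiff e₁).hasFDerivAt.add hB).congr_of_eventuallyEq (heq 1), ?_⟩
    rw [← hlap x hx, lap, add_apply, add_apply]
    linarith
  · have hcomp : ∀ x ∈ K, x ≠ 0 → ∀ i : Fin 2, fderivWithin ℝ f K x (EuclideanSpace.single i 1) =
        (gradientWithin S K x - logGrad x) i := by
      intro x hx hx0 i
      rw [(hfd x hx hx0).fderivWithin_apply (hU x hx), EuclideanSpace.inner_single_right]
      simp
    intro x hx
    refine ⟨fun h h' => ?_, fun h h' => ?_⟩
    · have hx0 : x ≠ 0 := by
        rintro rfl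
        simp at h
        exact (half_pos h₁).ne h
      rw [← hcomp x hx hx0 0]
      refine (hbd x ?_ ?_).1 ((abs_eq (by linarith)).1 h)
      · rw [frontier_rect h₁ h₂]
        exact ⟨hx, fun hr => hr.1.ne h⟩
      · exact fun hc => h'.ne ((abs_eq (by linarith)).2 hc.2)
    · have hx0 : x ≠ 0 := by
        rintro rfl
        simp at h
        exact (half_pos h₂).ne h
      rw [← hcomp x hx hx0 1]
      refine (hbd x ?_ ?_).2 ((abs_eq (by linarith)).1 h)
      · rw [frontier_rect h₁ h₂]
        exact ⟨hx, fun hr => hr.2.ne h⟩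
      · exact fun hc => h'.ne ((abs_eq (by linarith)).2 hc.1)

lemma integrableOn_ball_norm_rpow {q : ℝ} (hq : q < 2) (r : ℝ) :
    IntegrableOn (fun x : E2 => ‖x‖ ^ (-q)) (ball 0 r) := by
  refine integrableOn_ball_of_norm_le_rpow (C := 1) (α := q) (by simp) (by simpa using hq)
    (ae_of_all _ fun x => ?_)
    (measurable_norm.pow_const _).aestronglyMeasurable
  rw [Real.norm_of_nonneg (by positivity), one_mul]

lemma integrableOn_ball_norm_inv (r : ℝ) :
    IntegrableOn (fun x : E2 => ‖x‖⁻¹) (ball 0 r) := by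
  simpa [Real.rpow_neg_one] using integrableOn_ball_norm_rpow (q := 1) (by norm_num) r

lemma integral_annulus_norm_sq_inv {η r : ℝ} (hη : 0 < η) (hr : η ≤ r) :
    ∫ x in ball (0 : E2) r \ ball 0 η, (‖x‖ ^ 2)⁻¹ = 2 * Real.pi * Real.log (r / η) := by
  have h := integral_fun_norm_addHaar (volume : Measure E2)
    ((Set.Ico η r).indicator fun t : ℝ => (t ^ 2)⁻¹)
  have h1 : ∀ x : E2, (Set.Ico η r).indicator (fun t : ℝ => (t ^ 2)⁻¹) ‖x‖ =
      (ball (0 : E2) r \ ball 0 η).indicator (fun x => (‖x‖ ^ 2)⁻¹) x := by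
    intro x
    simp only [Set.indicator, Set.mem_Ico, Set.mem_sdiff, mem_ball_zero_iff, not_lt, and_comm]
  have h2 : ∫ y in Set.Ioi (0 : ℝ), y ^ (2 - 1) • (Set.Ico η r).indicator (fun t : ℝ => (t ^ 2)⁻¹) y
      = Real.log (r / η) := by
    rw [← integral_inv_of_pos hη (hη.trans_le hr), intervalIntegral.integral_of_le hr,
      integral_Ioc_eq_integral_Ioo, ← integral_Ico_eq_integral_Ioo,
      ← integral_indicator measurableSet_Ioi, ← integral_indicator measurableSet_Ico]
    congr 1
    ext y
    by_cases hy : y ∈ Set.Ico η r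
    · have hy0 : 0 < y := hη.trans_le hy.1
      simp [hy, hy0]
      field_simp
    · simp [hy]
  simp only [h1] at h
  rw [integral_indicator (measurableSet_ball.diff measurableSet_ball)] at h
  have h3 : (volume : Measure E2).real (ball 0 1) = Real.pi := by
    simp [Measure.real, EuclideanSpace.volume_ball_fin_two, Real.pi_pos.le]
  rw [h, finrank_euclideanSpace_fin, h2, h3]
  simp [mul_assoc]

lemma integrableOn_inner_logGrad {l₁ l₂ : ℝ} (h₁ : l₁ ≤ 4) (h₂ : l₂ ≤ 4) {W : E2 → E2}
    (hW : ContinuousOn W (closedRect l₁ l₂)) :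
    IntegrableOn (fun x => inner ℝ (logGrad x) (W x)) (rect l₁ l₂) := by
  have hsub := rect_subset_closedRect l₁ l₂
  obtain ⟨C, hC⟩ := (isCompact_closedRect l₁ l₂).exists_bound_of_continuousOn hW
  have hmeas : Measurable logGrad := by unfold logGrad; fun_prop
  refine Integrable.mono' (((integrableOn_ball_norm_inv 3).mono_set
    (hsub.trans (closedRect_subset_ball h₁ h₂))).mul_const C)
    (hmeas.aestronglyMeasurable.inner
      ((hW.mono hsub).aestronglyMeasurable (isOpen_rect _ _).measurableSet)) ?_
  filter_upwards [ae_restrict_mem (isOpen_rect l₁ l₂).measurableSet] with x hx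
  refine (norm_inner_le_norm _ _).trans ?_
  rw [norm_logGrad]
  exact mul_le_mul_of_nonneg_left (hC x (hsub hx)) (by positivity)

lemma integral_inner_logGrad_eq_zero {l₁ l₂ : ℝ} (h₁ : 0 < l₁) (h₂ : 0 < l₂) (h₁' : l₁ ≤ 4)
    (h₂' : l₂ ≤ 4) {Q : E2 → E2} (hQ : ContinuousOn Q (closedRect l₁ l₂))
    (hd : ∀ x ∈ rect l₁ l₂ \ {0}, HasDivAt Q 0 x) (hn : NormalZero l₁ l₂ Q) :
    ∫ x in rect l₁ l₂, inner ℝ (logGrad x) (Q x) = 0 := by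
  have hsub := rect_subset_closedRect l₁ l₂
  have hQm := (hQ.mono hsub).aestronglyMeasurable (μ := volume) (isOpen_rect _ _).measurableSet
  have hgc : ∀ ε : ℝ, 0 < ε → Continuous fun x : E2 => (‖x‖ ^ 2 + ε)⁻¹ • x := fun ε hε =>
    (Continuous.inv₀ (f := fun x : E2 => ‖x‖ ^ 2 + ε) (by fun_prop)
      fun x => by positivity).smul continuous_id
  have hz : ∀ ε : ℝ, 0 < ε → ∫ x in rect l₁ l₂, inner ℝ ((‖x‖ ^ 2 + ε)⁻¹ • x) (Q x) = 0 := by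
    intro ε hε
    refine integral_inner_gradient_eq_zero h₁ h₂ hQ hd hn ?_ (hgc ε hε).continuousOn
      (fun x _ => hasGradientAt_log_norm_sq_add hε x)
    exact Continuous.continuousOn (continuous_iff_continuousAt.2 fun x =>
      (hasGradientAt_log_norm_sq_add hε x).continuousAt)
  have hlim : Tendsto (fun ε : ℝ => ∫ x in rect l₁ l₂, inner ℝ ((‖x‖ ^ 2 + ε)⁻¹ • x) (Q x))
      (nhdsWithin 0 (Set.Ioi 0)) (nhds (∫ x in rect l₁ l₂, inner ℝ (logGrad x) (Q x))) := by
    refine tendsto_integral_filter_of_dominated_convergence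
      (fun x => |inner ℝ (logGrad x) (Q x)|) ?_ ?_
      (integrableOn_inner_logGrad h₁' h₂' hQ).abs ?_
    · filter_upwards [self_mem_nhdsWithin] with ε hε
      exact (hgc ε hε).aestronglyMeasurable.inner hQm
    · filter_upwards [self_mem_nhdsWithin] with ε hε
      refine ae_restrict_rect_of_ne_zero fun x hx => ?_
      have hx0 : 0 < ‖x‖ := norm_pos_iff.2 hx.2
      have hε' : 0 < ε := hε
      rw [logGrad, inner_smul_left, inner_smul_left, Real.norm_eq_abs, abs_mul, abs_mul]
      refine mul_le_mul_of_nonneg_right ?_ (abs_nonneg _)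
      simp only [conj_trivial]
      rw [abs_of_pos (by positivity), abs_of_pos (by positivity)]
      exact inv_anti₀ (by positivity) (by linarith)
    · refine ae_restrict_rect_of_ne_zero fun x hx => ?_
      have hx0 : ‖x‖ ^ 2 + 0 ≠ 0 := by simpa using hx.2
      have : ContinuousAt (fun ε : ℝ => inner ℝ ((‖x‖ ^ 2 + ε)⁻¹ • x) (Q x)) 0 := by
        fun_prop (disch := assumption)
      have := this.tendsto
      rw [add_zero] at this
      exact this.mono_left nhdsWithin_le_nhds
  refine tendsto_nhds_unique hlim (tendsto_const_nhds.congr' ?_)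
  filter_upwards [self_mem_nhdsWithin] with ε hε using (hz ε hε).symm

/-- Energy bounds for the regular part of the gradient of a solution of the cell problem. -/
lemma GoodF.exists_regular_gradient {l₁ l₂ : ℝ} (h₁ : 1 ≤ l₁) (h₁' : l₁ ≤ 4) (h₂ : 1 ≤ l₂)
    (h₂' : l₂ ≤ 4) {f : E2 → ℝ} (hf : GoodF l₁ l₂ f) :
    ∃ P : E2 → E2, ContinuousOn P (closedRect l₁ l₂) ∧
      (∀ x ∈ rect l₁ l₂ \ {0}, ‖fderiv ℝ f x‖ = ‖P x - logGrad x‖) ∧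
      ∫ x in rect l₁ l₂, ‖P x‖ ^ 2 ≤ 400 * volume.real (ball (0 : E2) 3) ∧
      |∫ x in rect l₁ l₂, inner ℝ (logGrad x) (P x)| ≤ 20 * ∫ x in ball (0 : E2) 3, ‖x‖⁻¹ := by
  have p₁ : 0 < l₁ := by linarith
  have p₂ : 0 < l₂ := by linarith
  obtain ⟨S, P, hS, hP, hSP, hfP, hdP, hnP⟩ := hf.exists_gradient p₁ p₂
  have hsub := rect_subset_closedRect l₁ l₂
  have hball : rect l₁ l₂ ⊆ ball 0 3 := hsub.trans (closedRect_subset_ball h₁' h₂')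
  have hmeas := (isOpen_rect l₁ l₂).measurableSet
  have hint : ∀ {φ : E2 → ℝ}, ContinuousOn φ (closedRect l₁ l₂) →
      IntegrableOn φ (rect l₁ l₂) := fun h =>
    (h.integrableOn_compact (isCompact_closedRect _ _)).mono_set hsub
  set V := fluxField (l₁ / 2) (l₂ / 2) with hV
  have hVc : ContinuousOn V (closedRect l₁ l₂) :=
    (continuous_fluxField (half_pos p₁) (half_pos p₂)).continuousOn
  have hQ : ContinuousOn (fun x => P x - V x) (closedRect l₁ l₂) := hP.sub hVc
  have hdQ : ∀ x ∈ rect l₁ l₂ \ {0}, HasDivAt (fun x => P x - V x) 0 x := by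
    intro x hx
    convert (hdP x hx).sub (hasDivAt_fluxField (half_pos p₁) (half_pos p₂) x) using 1
    field_simp
    ring
  have hnQ : NormalZero l₁ l₂ (fun x => P x - V x) := by
    intro x hx
    have a := hnP x hx
    have b := normalZero_logGrad_sub_fluxField p₁ p₂ x hx
    simp only [PiLp.sub_apply] at a b ⊢
    exact ⟨fun h h' => by linarith [a.1 h h', b.1 h h'],
      fun h h' => by linarith [a.2 h h', b.2 h h']⟩
  refine ⟨P, hP, fun x hx => ?_, ?_, ?_⟩
  · rw [(hfP x hx).hasFDerivAt.fderiv, LinearIsometryEquiv.norm_map]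
  · have horth := integral_inner_gradient_eq_zero p₁ p₂ hQ hdQ hnQ hS hP
      (fun x hx => hSP x hx.1)
    have hP2 : IntegrableOn (fun x => ‖P x‖ ^ 2) (rect l₁ l₂) := hint (hP.norm.pow 2)
    have hPQ : IntegrableOn (fun x => 2 * inner ℝ (P x) (P x - V x)) (rect l₁ l₂) :=
      hint ((hP.inner hQ).const_smul (2 : ℝ))
    calc ∫ x in rect l₁ l₂, ‖P x‖ ^ 2
        = ∫ x in rect l₁ l₂, (‖P x‖ ^ 2 - 2 * inner ℝ (P x) (P x - V x)) := by
          rw [integral_sub hP2 hPQ, integral_const_mul, horth]; ring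
      _ ≤ ∫ x in rect l₁ l₂, (400 : ℝ) := by
          refine setIntegral_mono_on (hP2.sub hPQ)
            (integrableOn_const (measure_ne_top_of_subset hball measure_ball_lt_top.ne)) hmeas
            fun x hx => ?_
          have e : ‖V x‖ ^ 2 = ‖P x‖ ^ 2 - 2 * inner ℝ (P x) (P x - V x) + ‖P x - V x‖ ^ 2 := by
            rw [← norm_sub_sq_real, sub_sub_cancel]
          have := norm_fluxField_le h₁ h₂ (hsub hx)
          nlinarith [sq_nonneg ‖P x - V x‖, norm_nonneg (V x)]
      _ ≤ 400 * volume.real (ball (0 : E2) 3) := by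
          rw [setIntegral_const, smul_eq_mul, mul_comm]
          exact mul_le_mul_of_nonneg_left (measureReal_mono hball measure_ball_lt_top.ne)
            (by norm_num)
  · have horth := integral_inner_logGrad_eq_zero p₁ p₂ h₁' h₂' hQ hdQ hnQ
    simp only [inner_sub_right] at horth
    rw [integral_sub (integrableOn_inner_logGrad h₁' h₂' hP)
      (integrableOn_inner_logGrad h₁' h₂' hVc), sub_eq_zero] at horth
    rw [horth, ← integral_const_mul]
    have hb := (integrableOn_ball_norm_inv 3).const_mul 20
    refine abs_integral_le_integral_abs.trans ?_
    calc ∫ x in rect l₁ l₂, |inner ℝ (logGrad x) (V x)|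
        ≤ ∫ x in rect l₁ l₂, 20 * ‖x‖⁻¹ := by
          refine setIntegral_mono_on (integrableOn_inner_logGrad h₁' h₂' hVc).abs
            (IntegrableOn.mono_set hb hball) hmeas fun x hx => ?_
          refine (abs_real_inner_le_norm _ _).trans ?_
          rw [norm_logGrad, mul_comm]
          exact mul_le_mul_of_nonneg_right (norm_fluxField_le h₁ h₂ (hsub hx)) (by positivity)
      _ ≤ _ := setIntegral_mono_set hb (ae_of_all _ fun x => by positivity)
          (LE.le.eventuallyLE hball)

lemma integral_norm_sq_inv_rect_sdiff_ball {l₁ l₂ : ℝ} (h₁ : 1 ≤ l₁) (h₁' : l₁ ≤ 4)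
    (h₂ : 1 ≤ l₂) (h₂' : l₂ ≤ 4) :
    ∃ K : ℝ, |K| ≤ 4 * volume.real (ball (0 : E2) 3) + 2 * Real.pi * Real.log 2 ∧
      ∀ η : ℝ, 0 < η → η ≤ 1 / 2 → IntegrableOn (fun x => (‖x‖ ^ 2)⁻¹) (rect l₁ l₂ \ ball 0 η) ∧
        (∫ x in rect l₁ l₂ \ ball 0 η, (‖x‖ ^ 2)⁻¹) + 2 * Real.pi * Real.log η = K := by
  have hball : rect l₁ l₂ ⊆ ball 0 3 :=
    (rect_subset_closedRect l₁ l₂).trans (closedRect_subset_ball h₁' h₂')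
  have hmeas := (isOpen_rect l₁ l₂).measurableSet
  have hhalf : ball (0 : E2) (1 / 2) ⊆ rect l₁ l₂ := by
    intro x hx
    rw [mem_ball_zero_iff] at hx
    exact ⟨by linarith [PiLp.norm_apply_le x 0, Real.norm_eq_abs (x 0)],
      by linarith [PiLp.norm_apply_le x 1, Real.norm_eq_abs (x 1)]⟩
  have hbd : ∀ η : ℝ, 0 < η → ∀ x ∈ rect l₁ l₂ \ ball 0 η, (‖x‖ ^ 2)⁻¹ ≤ (η ^ 2)⁻¹ := by
    intro η hη x hx
    have : η ≤ ‖x‖ := by simpa using hx.2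
    gcongr
  have hfin : ∀ η : ℝ, volume (rect l₁ l₂ \ ball 0 η) ≠ ⊤ := fun η =>
    measure_ne_top_of_subset (Set.sdiff_subset.trans hball) measure_ball_lt_top.ne
  have hint : ∀ η : ℝ, 0 < η →
      IntegrableOn (fun x : E2 => (‖x‖ ^ 2)⁻¹) (rect l₁ l₂ \ ball 0 η) := by
    intro η hη
    refine IntegrableOn.of_bound (hfin η).lt_top (by
      exact (measurable_norm.pow_const 2).inv.aestronglyMeasurable) (η ^ 2)⁻¹ ?_
    filter_upwards [ae_restrict_mem (hmeas.diff measurableSet_ball)] with x hx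
    rw [Real.norm_of_nonneg (by positivity)]
    exact hbd η hη x hx
  have hlog := Real.log_nonneg (one_le_two (α := ℝ))
  refine ⟨(∫ x in rect l₁ l₂ \ ball 0 (1 / 2), (‖x‖ ^ 2)⁻¹) - 2 * Real.pi * Real.log 2, ?_,
    fun η hη hη' => ⟨hint η hη, ?_⟩⟩
  · have h0 : 0 ≤ ∫ x in rect l₁ l₂ \ ball 0 (1 / 2), (‖x‖ ^ 2)⁻¹ :=
      integral_nonneg fun x => by positivity
    have h4 : ∫ x in rect l₁ l₂ \ ball 0 (1 / 2), (‖x‖ ^ 2)⁻¹ ≤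
        4 * volume.real (ball (0 : E2) 3) := by
      calc _ ≤ ∫ x in rect l₁ l₂ \ ball 0 (1 / 2), (4 : ℝ) := by
            refine setIntegral_mono_on (hint _ (by norm_num)) (integrableOn_const (hfin _))
              (hmeas.diff measurableSet_ball) fun x hx => ?_
            exact (hbd _ (by norm_num) x hx).trans (by norm_num)
        _ ≤ _ := by
            rw [setIntegral_const, smul_eq_mul, mul_comm]
            exact mul_le_mul_of_nonneg_left (measureReal_mono (Set.sdiff_subset.trans hball)
              measure_ball_lt_top.ne) (by norm_num)
    have : 0 ≤ 2 * Real.pi * Real.log 2 := by positivity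
    exact abs_le.2 ⟨by linarith [measureReal_nonneg (μ := volume) (s := ball (0 : E2) 3)],
      by linarith⟩
  · have hsplit : rect l₁ l₂ \ ball 0 η =
        (rect l₁ l₂ \ ball 0 (1 / 2)) ∪ (ball 0 (1 / 2) \ ball 0 η) := by
      rw [← Set.sdiff_union_sdiff_cancel hhalf (ball_subset_ball hη')]
    have hdisj : Disjoint (rect l₁ l₂ \ ball 0 (1 / 2)) (ball 0 (1 / 2) \ ball (0 : E2) η) :=
      Set.disjoint_left.2 fun x hx hx' => hx.2 hx'.1
    rw [hsplit, setIntegral_union hdisj (measurableSet_ball.diff measurableSet_ball)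
      (hint _ (by norm_num)) ((hint η hη).mono_set (by
        rw [hsplit]; exact Set.subset_union_right)), integral_annulus_norm_sq_inv hη hη',
      Real.log_div (by norm_num) hη.ne', Real.log_div (by norm_num) (by norm_num), Real.log_one]
    ring

lemma GoodF.exists_renormalized_energy {l₁ l₂ : ℝ} (h₁ : 1 ≤ l₁) (h₁' : l₁ ≤ 4) (h₂ : 1 ≤ l₂)
    (h₂' : l₂ ≤ 4) {f : E2 → ℝ} (hf : GoodF l₁ l₂ f) :
    ∃ l : ℝ, |l| ≤ 404 * volume.real (ball (0 : E2) 3) + 2 * Real.pi * Real.log 2 +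
        40 * ∫ x in ball (0 : E2) 3, ‖x‖⁻¹ ∧
      Tendsto (fun η : ℝ => (∫ x in rect l₁ l₂ \ ball (0 : E2) η, ‖fderiv ℝ f x‖ ^ 2) +
        2 * Real.pi * Real.log η) (nhdsWithin 0 (Set.Ioi 0)) (nhds l) := by
  obtain ⟨P, hP, hfP, hP2, hLP⟩ := hf.exists_regular_gradient h₁ h₁' h₂ h₂'
  obtain ⟨K, hK, hKη⟩ := integral_norm_sq_inv_rect_sdiff_ball h₁ h₁' h₂ h₂'
  have hmeas := (isOpen_rect l₁ l₂).measurableSet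
  have i1 : IntegrableOn (fun x => ‖P x‖ ^ 2) (rect l₁ l₂) :=
    ((hP.norm.pow 2).integrableOn_compact (isCompact_closedRect _ _)).mono_set
      (rect_subset_closedRect _ _)
  have i2 : IntegrableOn (fun x => 2 * inner ℝ (logGrad x) (P x)) (rect l₁ l₂) :=
    (integrableOn_inner_logGrad h₁' h₂' hP).const_mul 2
  have i3 : IntegrableOn (fun x => ‖P x‖ ^ 2 - 2 * inner ℝ (logGrad x) (P x)) (rect l₁ l₂) :=
    i1.sub i2
  refine ⟨K + ∫ x in rect l₁ l₂, (‖P x‖ ^ 2 - 2 * inner ℝ (logGrad x) (P x)), ?_, ?_⟩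
  · rw [integral_sub i1 i2, integral_const_mul]
    have h0 : 0 ≤ ∫ x in rect l₁ l₂, ‖P x‖ ^ 2 := integral_nonneg fun x => by positivity
    have a := abs_le.1 hK
    have b := abs_le.1 hLP
    exact abs_le.2 ⟨by linarith [measureReal_nonneg (μ := volume) (s := ball (0 : E2) 3)],
      by linarith⟩
  · have hcover : AECover (volume.restrict (rect l₁ l₂)) (nhdsWithin (0 : ℝ) (Set.Ioi 0))
        (fun η => (ball (0 : E2) η)ᶜ) := by
      refine ⟨ae_restrict_rect_of_ne_zero fun x hx => ?_, fun η => measurableSet_ball.compl⟩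
      filter_upwards [nhdsWithin_le_nhds (Iio_mem_nhds (norm_pos_iff.2 hx.2))] with η hη
      simpa using (Set.mem_Iio.1 hη).le
    refine ((hcover.integral_tendsto_of_countably_generated i3).const_add K).congr' ?_
    filter_upwards [Ioc_mem_nhdsGT (show (0 : ℝ) < 1 / 2 by norm_num)] with η hη
    obtain ⟨hi, hη'⟩ := hKη η hη.1 hη.2
    rw [Measure.restrict_restrict measurableSet_ball.compl, Set.inter_comm, ← Set.sdiff_eq, ← hη']
    have : ∫ x in rect l₁ l₂ \ ball 0 η, ‖fderiv ℝ f x‖ ^ 2 =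
        ∫ x in rect l₁ l₂ \ ball 0 η,
          ((‖x‖ ^ 2)⁻¹ + (‖P x‖ ^ 2 - 2 * inner ℝ (logGrad x) (P x))) := by
      refine setIntegral_congr_fun (hmeas.diff measurableSet_ball) fun x hx => ?_
      have hx0 : x ≠ 0 := by
        rintro rfl
        exact hx.2 (mem_ball_self hη.1)
      beta_reduce
      rw [hfP x ⟨hx.1, hx0⟩, norm_sub_sq_real, norm_logGrad, real_inner_comm, inv_pow]
      ring
    rw [this, integral_add hi (i3.mono_set Set.sdiff_subset)]
    ring

lemma add_rpow_le {a b q : ℝ} (ha : 0 ≤ a) (hb : 0 ≤ b) (hq : 0 ≤ q) (hq2 : q ≤ 2) :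
    (a + b) ^ q ≤ 4 * (1 + a ^ 2 + b ^ q) := by
  have h4 : (2 : ℝ) ^ q ≤ 4 := by
    calc (2 : ℝ) ^ q ≤ 2 ^ (2 : ℝ) := Real.rpow_le_rpow_of_exponent_le one_le_two hq2
      _ = 4 := by norm_num
  have haq : a ^ q ≤ 1 + a ^ 2 := by
    rcases le_total a 1 with h | h
    · linarith [Real.rpow_le_one ha h hq, sq_nonneg a]
    · have := Real.rpow_le_rpow_of_exponent_le h hq2
      rw [Real.rpow_two] at this
      linarith
  have hmax : (max a b) ^ q ≤ a ^ q + b ^ q := by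
    rcases max_choice a b with h | h <;> rw [h]
    · linarith [Real.rpow_nonneg hb q]
    · linarith [Real.rpow_nonneg ha q]
  calc (a + b) ^ q ≤ (2 * max a b) ^ q :=
        Real.rpow_le_rpow (by positivity) (by linarith [le_max_left a b, le_max_right a b]) hq
    _ = 2 ^ q * (max a b) ^ q := Real.mul_rpow zero_le_two (ha.trans (le_max_left a b))
    _ ≤ 4 * (1 + a ^ 2 + b ^ q) := by
        refine mul_le_mul h4 (by linarith) ?_ (by norm_num)
        exact Real.rpow_nonneg (ha.trans (le_max_left a b)) q

lemma GoodF.integral_norm_fderiv_rpow_le {l₁ l₂ q : ℝ} (h₁ : 1 ≤ l₁) (h₁' : l₁ ≤ 4)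
    (h₂ : 1 ≤ l₂) (h₂' : l₂ ≤ 4) (hq : 0 ≤ q) (hq2 : q < 2) {f : E2 → ℝ} (hf : GoodF l₁ l₂ f) :
    ∫ x in rect l₁ l₂, ‖fderiv ℝ f x‖ ^ q ≤
      4 * (401 * volume.real (ball (0 : E2) 3) + ∫ x in ball (0 : E2) 3, ‖x‖ ^ (-q)) := by
  obtain ⟨P, hP, hfP, hP2, -⟩ := hf.exists_regular_gradient h₁ h₁' h₂ h₂'
  have hball : rect l₁ l₂ ⊆ ball 0 3 :=
    (rect_subset_closedRect l₁ l₂).trans (closedRect_subset_ball h₁' h₂')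
  have i0 : IntegrableOn (fun _ : E2 => (1 : ℝ)) (rect l₁ l₂) :=
    integrableOn_const (measure_ne_top_of_subset hball measure_ball_lt_top.ne)
  have i1 : IntegrableOn (fun x => ‖P x‖ ^ 2) (rect l₁ l₂) :=
    ((hP.norm.pow 2).integrableOn_compact (isCompact_closedRect _ _)).mono_set
      (rect_subset_closedRect _ _)
  have i2 := (integrableOn_ball_norm_rpow hq2 3).mono_set hball
  have i01 : IntegrableOn (fun x => 1 + ‖P x‖ ^ 2) (rect l₁ l₂) := i0.add i1
  calc ∫ x in rect l₁ l₂, ‖fderiv ℝ f x‖ ^ q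
      ≤ ∫ x in rect l₁ l₂, 4 * (1 + ‖P x‖ ^ 2 + ‖x‖ ^ (-q)) := by
        refine integral_mono_of_nonneg (ae_of_all _ fun x => by positivity)
          ((i01.add i2).const_mul 4) (ae_restrict_rect_of_ne_zero fun x hx => ?_)
        beta_reduce
        rw [hfP x hx, Real.rpow_neg (norm_nonneg x), ← Real.inv_rpow (norm_nonneg x),
          ← norm_logGrad]
        exact (Real.rpow_le_rpow (norm_nonneg _) (norm_sub_le _ _) hq).trans
          (add_rpow_le (norm_nonneg _) (norm_nonneg _) hq hq2.le)
    _ = 4 * (volume.real (rect l₁ l₂) + (∫ x in rect l₁ l₂, ‖P x‖ ^ 2) +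
          ∫ x in rect l₁ l₂, ‖x‖ ^ (-q)) := by
        rw [integral_const_mul, integral_add i01 i2, integral_add i0 i1, setIntegral_const]
        simp
    _ ≤ _ := by
        have a := measureReal_mono (μ := volume) hball measure_ball_lt_top.ne
        have b := setIntegral_mono_set (integrableOn_ball_norm_rpow hq2 3)
          (ae_of_all _ fun x => by positivity) (LE.le.eventuallyLE hball)
        linarith

lemma mem_Icc_one_four {l : ℝ}
    (h : l ∈ Set.Icc (Real.sqrt (2 * Real.pi) / 2) (3 * Real.sqrt (2 * Real.pi) / 2)) :
    1 ≤ l ∧ l ≤ 4 := by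
  have a : 2 ≤ Real.sqrt (2 * Real.pi) := Real.le_sqrt_of_sq_le (by linarith [Real.pi_gt_three])
  have b : Real.sqrt (2 * Real.pi) ≤ 8 / 3 :=
    Real.sqrt_le_iff.2 ⟨by norm_num, by linarith [Real.pi_lt_d2]⟩
  exact ⟨by linarith [h.1], by linarith [h.2]⟩

/-- Lemma 4.16: uniform energy estimates for the single-vortex Neumann problem on
nearly-square rectangles of area `2π`, with constants independent of the sidelengths. -/
theorem stmt14 :
    ∃ C : ℝ, 0 < C ∧
      (∀ l₁ l₂ : ℝ,
        l₁ ∈ Set.Icc (Real.sqrt (2 * Real.pi) / 2) (3 * Real.sqrt (2 * Real.pi) / 2) →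
        l₂ ∈ Set.Icc (Real.sqrt (2 * Real.pi) / 2) (3 * Real.sqrt (2 * Real.pi) / 2) →
        ∀ f : E2 → ℝ, GoodF l₁ l₂ f →
          ∃ l : ℝ, |l| ≤ C ∧
            Tendsto (fun η : ℝ =>
                (∫ x in rect l₁ l₂ \ ball (0 : E2) η, ‖fderiv ℝ f x‖ ^ 2 ∂volume) +
                  2 * Real.pi * Real.log η)
              (nhdsWithin 0 (Set.Ioi 0)) (nhds l)) ∧
      (∀ q : ℝ, 1 ≤ q → q < 2 → ∃ Cq : ℝ, 0 < Cq ∧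
        ∀ l₁ l₂ : ℝ,
          l₁ ∈ Set.Icc (Real.sqrt (2 * Real.pi) / 2) (3 * Real.sqrt (2 * Real.pi) / 2) →
          l₂ ∈ Set.Icc (Real.sqrt (2 * Real.pi) / 2) (3 * Real.sqrt (2 * Real.pi) / 2) →
          ∀ f : E2 → ℝ, GoodF l₁ l₂ f →
            (∫ x in rect l₁ l₂, ‖fderiv ℝ f x‖ ^ q ∂volume) ≤ Cq) := by
  have hv := measureReal_nonneg (μ := volume) (s := ball (0 : E2) 3)
  have hpos : ∀ q : ℝ, 0 ≤ ∫ x in ball (0 : E2) 3, ‖x‖ ^ (-q) := fun q =>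
    integral_nonneg fun x => by positivity
  have hpos' : 0 ≤ ∫ x in ball (0 : E2) 3, ‖x‖⁻¹ := integral_nonneg fun x => by positivity
  have hlog := Real.log_nonneg (one_le_two (α := ℝ))
  refine ⟨404 * volume.real (ball (0 : E2) 3) + 2 * Real.pi * Real.log 2 +
    40 * (∫ x in ball (0 : E2) 3, ‖x‖⁻¹) + 1, by positivity, fun l₁ l₂ h₁ h₂ f hf => ?_,
    fun q hq hq2 => ⟨4 * (401 * volume.real (ball (0 : E2) 3) +
      ∫ x in ball (0 : E2) 3, ‖x‖ ^ (-q)) + 1, by linarith [hpos q], fun l₁ l₂ h₁ h₂ f hf => ?_⟩⟩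
  · obtain ⟨a₁, b₁⟩ := mem_Icc_one_four h₁
    obtain ⟨a₂, b₂⟩ := mem_Icc_one_four h₂
    obtain ⟨l, hl, hlim⟩ := hf.exists_renormalized_energy a₁ b₁ a₂ b₂
    exact ⟨l, by linarith, hlim⟩
  · obtain ⟨a₁, b₁⟩ := mem_Icc_one_four h₁
    obtain ⟨a₂, b₂⟩ := mem_Icc_one_four h₂
    linarith [hf.integral_norm_fderiv_rpow_le a₁ b₁ a₂ b₂ (zero_le_one.trans hq) hq2]
end

section
/- Let ω ⊆ ℝ² be a convex set of positive finite Lebesgue measure whose diameter is at most D. Then for every x ∈ ω and every r with 0 < r ≤ D, one has |ω ∩ B(x,r)| ≥ (r²/D²) · |ω|, where |·| denotes Lebesgue measure and B(x,r) the open ball of center x and radius r. -/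
open MeasureTheory Metric

/-- Shrinking a convex set towards one of its points `x` by a factor `c ∈ [0, 1]` keeps it inside
the set, so its part in a ball about `x` loses at most a factor `c ^ dim` of measure. -/
theorem Convex.addHaar_inter_ball_mul_ge {E : Type*} [NormedAddCommGroup E] [NormedSpace ℝ E]
    [MeasurableSpace E] [BorelSpace E] [FiniteDimensional ℝ E] (μ : Measure E)
    [μ.IsAddHaarMeasure] {s : Set E} (hs : Convex ℝ s) {x : E} (hx : x ∈ s) {c : ℝ} (hc : 0 < c)
    (hc1 : c ≤ 1) (R : ℝ) :
    ENNReal.ofReal (c ^ Module.finrank ℝ E) * μ (s ∩ ball x R) ≤ μ (s ∩ ball x (c * R)) := by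
  rw [← abs_of_pos (pow_pos hc (Module.finrank ℝ E)),
    ← Measure.addHaar_image_homothety μ x c (s ∩ ball x R)]
  refine measure_mono ?_
  rintro _ ⟨y, ⟨hys, hyR⟩, rfl⟩
  refine ⟨?_, ?_⟩
  · rw [AffineMap.homothety_eq_lineMap]
    exact hs.lineMap_mem hx hys ⟨hc.le, hc1⟩
  · rw [mem_ball] at hyR ⊢
    rw [dist_homothety_center, Real.norm_of_nonneg hc.le, dist_comm]
    exact mul_lt_mul_of_pos_left hyR hc

/-- Up to a null set, a set of diameter at most `R` lies in the open ball of radius `R` about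
each of its points. -/
theorem addHaar_inter_ball_eq_of_ediam_le {E : Type*} [NormedAddCommGroup E] [NormedSpace ℝ E]
    [MeasurableSpace E] [BorelSpace E] [FiniteDimensional ℝ E] (μ : Measure E)
    [μ.IsAddHaarMeasure] {s : Set E} {x : E} (hx : x ∈ s) {R : ℝ} (hR : 0 < R)
    (hdiam : ediam s ≤ ENNReal.ofReal R) : μ (s ∩ ball x R) = μ s := by
  refine le_antisymm (measure_mono Set.inter_subset_left) ?_
  have hsub : s ⊆ s ∩ ball x R ∪ sphere x R := fun y hy ↦ by
    have h : dist y x ≤ R := by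
      have := (edist_le_ediam_of_mem hy hx).trans hdiam
      rwa [edist_dist, ENNReal.ofReal_le_ofReal_iff hR.le] at this
    exact h.lt_or_eq.imp (fun h ↦ ⟨hy, h⟩) id
  calc μ s ≤ μ (s ∩ ball x R) + μ (sphere x R) := (measure_mono hsub).trans (measure_union_le _ _)
    _ = μ (s ∩ ball x R) := by rw [Measure.addHaar_sphere_of_ne_zero μ x hR.ne', add_zero]

/-- Lemma 7.3: a uniform density estimate for convex sets of diameter at most `D`:
for every `x ∈ ω` and `0 < r ≤ D`, `|ω ∩ B(x,r)| ≥ (r²/D²)|ω|`. -/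
theorem stmt16 (ω : Set (EuclideanSpace ℝ (Fin 2))) (hω : Convex ℝ ω)
    (hpos : 0 < volume ω) (hfin : volume ω < ⊤)
    (D : ℝ) (hD : EMetric.diam ω ≤ ENNReal.ofReal D)
    (x : EuclideanSpace ℝ (Fin 2)) (hx : x ∈ ω)
    (r : ℝ) (hr : 0 < r) (hrD : r ≤ D) :
    r ^ 2 / D ^ 2 * (volume ω).toReal ≤ (volume (ω ∩ ball x r)).toReal := by
  have hD0 : 0 < D := hr.trans_le hrD
  have h := hω.addHaar_inter_ball_mul_ge volume hx (div_pos hr hD0) ((div_le_one hD0).2 hrD) D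
  rw [addHaar_inter_ball_eq_of_ediam_le volume hx hD0 hD, div_mul_cancel₀ r hD0.ne',
    finrank_euclideanSpace_fin, div_pow] at h
  have h' := ENNReal.toReal_mono (measure_ne_top_of_subset Set.inter_subset_left hfin.ne) h
  rwa [ENNReal.toReal_mul, ENNReal.toReal_ofReal (by positivity)] at h'
end

section
/- Let m > 0, let Λ ⊂ ℝ² be locally finite, set ν = 2π Σ_{p∈Λ} δ_p, and let j ∈ L¹_loc(ℝ², ℝ²) satisfy curl j = ν − m distributionally in ℝ². Assume there is a constant C₀ > 0 such that ∫_{B_R} |j| ≤ C₀ R² for every R ≥ 1, where B_R is the ball of radius R centered at 0. Then ν(B_R) ∼ π m R² as R → ∞, i.e. 2π · #(Λ ∩ B_R) / (π m R²) → 1; in particular j belongs to the admissible class 𝒜_m. -/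
open MeasureTheory Metric Filter

/-- The number of points of a locally finite set in a bounded set, as a sum over the set. -/
lemma tsum_subtype_indicator_one {α : Type*} (Λ B : Set α) (h : (Λ ∩ B).Finite) :
    Summable (fun q : Λ => B.indicator (fun _ => (1 : ℝ)) (q : α)) ∧
      ∑' q : Λ, B.indicator (fun _ => (1 : ℝ)) (q : α) = ((Λ ∩ B).ncard : ℝ) := by
  have hfin : ∀ x ∉ h.toFinset, (Λ ∩ B).indicator (fun _ => (1 : ℝ)) x = 0 := by
    intro x hx
    exact Set.indicator_of_notMem (by simpa using hx) _
  have hs : HasSum _ _ := hasSum_sum_of_ne_finset_zero hfin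
  rw [Finset.sum_congr rfl (f := (Λ ∩ B).indicator fun _ => (1 : ℝ)) (g := fun _ => (1 : ℝ))
    (fun x hx => Set.indicator_of_mem (by simpa using hx) _), Finset.sum_const, nsmul_one,
    ← Set.ncard_eq_toFinset_card _ h, ← Set.indicator_indicator,
    ← hasSum_subtype_iff_indicator] at hs
  exact ⟨hs.summable, hs.tsum_eq⟩

/-- Testing the curl equation against a dilated bump function: the number of points of `Λ`
weighted by `ψ (· / R)` is `m R² ∫ ψ` up to an error of order `R`. -/
lemma abs_tsum_comp_inv_smul_sub_le (m : ℝ) (Λ : Set E2) (j : E2 → E2)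
    (hj : LocallyIntegrable j volume)
    (hcurl : ∀ φ : E2 → ℝ, ContDiff ℝ (⊤ : ℕ∞) φ → HasCompactSupport φ →
      -∫ x, (-(j x 0) * fderiv ℝ φ x (EuclideanSpace.single 1 1) +
          j x 1 * fderiv ℝ φ x (EuclideanSpace.single 0 1)) =
        2 * Real.pi * (∑' q : Λ, φ q) - m * ∫ x, φ x)
    (C₀ : ℝ) (hjbd : ∀ R : ℝ, 1 ≤ R → ∫ x in ball (0 : E2) R, ‖j x‖ ≤ C₀ * R ^ 2)
    (ψ : ContDiffBump (0 : E2)) :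
    ∃ A : ℝ, ∀ R : ℝ, 1 ≤ R →
      |2 * Real.pi * (∑' q : Λ, ψ (R⁻¹ • (q : E2))) - m * (R ^ 2 * ∫ x, ψ x)| ≤ A * R := by
  have hψ : ContDiff ℝ (⊤ : ℕ∞) ψ := ψ.contDiff
  obtain ⟨K, hK⟩ := (ψ.hasCompactSupport.fderiv (𝕜 := ℝ)).exists_bound_of_continuous
    (hψ.continuous_fderiv (by simp))
  have hK0 : 0 ≤ K := (norm_nonneg _).trans (hK 0)
  set ρ := ψ.rOut + 1 with hρ
  have hρ1 : 1 ≤ ρ := by linarith [ψ.rOut_pos]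
  refine ⟨2 * K * C₀ * ρ ^ 2, fun R hR => ?_⟩
  have hR0 : 0 < R := by linarith
  have hφ : ContDiff ℝ (⊤ : ℕ∞) (fun x : E2 => ψ (R⁻¹ • x)) :=
    hψ.comp (contDiff_const_smul _)
  have hφc : HasCompactSupport (fun x : E2 => ψ (R⁻¹ • x)) :=
    ψ.hasCompactSupport.comp_smul (inv_ne_zero hR0.ne')
  have hderiv (x v : E2) : fderiv ℝ (fun x : E2 => ψ (R⁻¹ • x)) x v
      = R⁻¹ * fderiv ℝ ψ (R⁻¹ • x) v := by
    rw [fderiv_comp_smul]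
    simp
  have key := hcurl _ hφ hφc
  rw [Measure.integral_comp_inv_smul_of_nonneg volume (fun x => ψ x) hR0.le,
    finrank_euclideanSpace_fin, smul_eq_mul] at key
  rw [← key, abs_neg, ← Real.norm_eq_abs]
  have hbound : ∀ x : E2,
      ‖-(j x 0) * fderiv ℝ (fun x : E2 => ψ (R⁻¹ • x)) x (EuclideanSpace.single 1 1) +
        j x 1 * fderiv ℝ (fun x : E2 => ψ (R⁻¹ • x)) x (EuclideanSpace.single 0 1)‖ ≤
      (ball (0 : E2) (ρ * R)).indicator (fun x => 2 * K * R⁻¹ * ‖j x‖) x := by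
    intro x
    rw [hderiv, hderiv]
    by_cases hx : x ∈ ball (0 : E2) (ρ * R)
    · rw [Set.indicator_of_mem hx]
      have hd (i : Fin 2) :
          ‖fderiv ℝ ψ (R⁻¹ • x) (EuclideanSpace.single i 1)‖ ≤ K := by
        refine (ContinuousLinearMap.le_opNorm _ _).trans ?_
        simpa using hK (R⁻¹ • x)
      have hc (i k : Fin 2) :
          ‖j x i‖ * (R⁻¹ * ‖fderiv ℝ ψ (R⁻¹ • x) (EuclideanSpace.single k 1)‖) ≤
            ‖j x‖ * (R⁻¹ * K) := by
        gcongr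
        · exact PiLp.norm_apply_le _ _
        · exact hd k
      refine (norm_add_le _ _).trans ?_
      rw [norm_mul, norm_mul, norm_neg, norm_mul, norm_mul,
        Real.norm_of_nonneg (inv_nonneg.2 hR0.le)]
      linarith [hc 0 1, hc 1 0]
    · rw [Set.indicator_of_notMem hx]
      have hx' : R⁻¹ • x ∉ tsupport ψ := by
        rw [ψ.tsupport_eq, mem_closedBall_zero_iff, norm_smul,
          Real.norm_of_nonneg (inv_nonneg.2 hR0.le), not_le]
        rw [mem_ball_zero_iff, not_lt] at hx
        rw [inv_mul_eq_div, lt_div_iff₀ hR0]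
        nlinarith
      have h0 : fderiv ℝ ψ (R⁻¹ • x) = 0 :=
        image_eq_zero_of_notMem_tsupport fun h => hx' (tsupport_fderiv_subset ℝ h)
      simp [h0]
  have hint : IntegrableOn j (ball (0 : E2) (ρ * R)) :=
    (hj.integrableOn_isCompact (isCompact_closedBall (0 : E2) (ρ * R))).mono_set
      ball_subset_closedBall
  refine (norm_integral_le_of_norm_le
    ((integrable_indicator_iff measurableSet_ball).2 (hint.norm.const_mul _))
    (ae_of_all _ hbound)).trans ?_
  rw [integral_indicator measurableSet_ball, integral_const_mul]
  calc 2 * K * R⁻¹ * ∫ x in ball (0 : E2) (ρ * R), ‖j x‖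
      ≤ 2 * K * R⁻¹ * (C₀ * (ρ * R) ^ 2) := by
        gcongr
        exact hjbd _ (by nlinarith)
    _ = 2 * K * C₀ * ρ ^ 2 * R := by field_simp

/-- The volume of a disc as a real number. -/
lemma volume_real_closedBall_E2 {r : ℝ} (hr : 0 ≤ r) :
    volume.real (closedBall (0 : E2) r) = Real.pi * r ^ 2 := by
  simp [Measure.real, EuclideanSpace.volume_closedBall_fin_two, hr, Real.pi_pos.le, mul_comm]

/-- The two-sided count of points of `Λ` in a disc. -/
lemma two_pi_ncard_inter_ball_bounds (m : ℝ) (hm : 0 < m) (Λ : Set E2)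
    (hΛ : ∀ K : Set E2, IsCompact K → (Λ ∩ K).Finite) (j : E2 → E2)
    (hj : LocallyIntegrable j volume)
    (hcurl : ∀ φ : E2 → ℝ, ContDiff ℝ (⊤ : ℕ∞) φ → HasCompactSupport φ →
      -∫ x, (-(j x 0) * fderiv ℝ φ x (EuclideanSpace.single 1 1) +
          j x 1 * fderiv ℝ φ x (EuclideanSpace.single 0 1)) =
        2 * Real.pi * (∑' q : Λ, φ q) - m * ∫ x, φ x)
    (C₀ : ℝ) (hjbd : ∀ R : ℝ, 1 ≤ R → ∫ x in ball (0 : E2) R, ‖j x‖ ≤ C₀ * R ^ 2)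
    {ε : ℝ} (hε : 0 < ε) (hε1 : ε < 1) :
    ∃ A : ℝ, ∀ R : ℝ, 1 ≤ R →
      m * Real.pi * (1 - ε) ^ 2 * R ^ 2 - A * R ≤
          2 * Real.pi * ((Λ ∩ ball (0 : E2) R).ncard : ℝ) ∧
        2 * Real.pi * ((Λ ∩ ball (0 : E2) R).ncard : ℝ) ≤
          m * Real.pi * (1 + ε) ^ 2 * R ^ 2 + A * R := by
  let ψ₁ : ContDiffBump (0 : E2) := ⟨1 - ε, 1, by linarith, by linarith⟩
  let ψ₂ : ContDiffBump (0 : E2) := ⟨1, 1 + ε, by linarith, by linarith⟩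
  obtain ⟨A₁, h₁⟩ := abs_tsum_comp_inv_smul_sub_le m Λ j hj hcurl C₀ hjbd ψ₁
  obtain ⟨A₂, h₂⟩ := abs_tsum_comp_inv_smul_sub_le m Λ j hj hcurl C₀ hjbd ψ₂
  refine ⟨max A₁ A₂, fun R hR => ?_⟩
  have hR0 : 0 < R := by linarith
  have hcount (r : ℝ) := tsum_subtype_indicator_one Λ (ball 0 r)
    ((hΛ _ (isCompact_closedBall 0 r)).subset
      (Set.inter_subset_inter_right _ ball_subset_closedBall))
  have hle (ψ : ContDiffBump (0 : E2)) (x : E2) :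
      ψ (R⁻¹ • x) ≤ (ball (0 : E2) (ψ.rOut * R)).indicator (fun _ => (1 : ℝ)) x := by
    by_cases hx : x ∈ ball (0 : E2) (ψ.rOut * R)
    · rw [Set.indicator_of_mem hx]
      exact ψ.le_one
    · rw [Set.indicator_of_notMem hx]
      refine (ψ.zero_of_le_dist ?_).le
      rw [mem_ball_zero_iff, not_lt] at hx
      rwa [dist_zero_right, norm_smul, Real.norm_of_nonneg (inv_nonneg.2 hR0.le),
        inv_mul_eq_div, le_div_iff₀ hR0]
  have hsum (ψ : ContDiffBump (0 : E2)) : Summable (fun q : Λ => ψ (R⁻¹ • (q : E2))) :=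
    (hcount _).1.of_nonneg_of_le (fun _ => ψ.nonneg) fun q => hle ψ q
  have hle₁ : ∑' q : Λ, ψ₁ (R⁻¹ • (q : E2)) ≤ ((Λ ∩ ball (0 : E2) R).ncard : ℝ) := by
    rw [← (hcount R).2]
    refine (hsum ψ₁).tsum_le_tsum (fun q => ?_) (hcount R).1
    simpa [ψ₁] using hle ψ₁ q
  have hle₂ : ((Λ ∩ ball (0 : E2) R).ncard : ℝ) ≤ ∑' q : Λ, ψ₂ (R⁻¹ • (q : E2)) := by
    rw [← (hcount R).2]
    refine (hcount R).1.tsum_le_tsum (fun q => ?_) (hsum ψ₂)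
    refine Set.indicator_le' (s := ball (0 : E2) R) (g := fun x => ψ₂ (R⁻¹ • x))
      (fun x hx => ?_) (fun x _ => ψ₂.nonneg) (q : E2)
    refine (ψ₂.one_of_mem_closedBall ?_).ge
    rw [mem_ball_zero_iff] at hx
    rw [mem_closedBall_zero_iff, norm_smul, Real.norm_of_nonneg (inv_nonneg.2 hR0.le),
      inv_mul_eq_div, div_le_iff₀ hR0]
    simpa [ψ₂] using hx.le
  have hI₁ : Real.pi * (1 - ε) ^ 2 ≤ ∫ x, ψ₁ x := by
    rw [← volume_real_closedBall_E2 (by linarith)]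
    exact ψ₁.measure_closedBall_le_integral volume
  have hI₂ : ∫ x, ψ₂ x ≤ Real.pi * (1 + ε) ^ 2 := by
    rw [← volume_real_closedBall_E2 (by linarith)]
    exact ψ₂.integral_le_measure_closedBall volume
  have hmR : 0 ≤ m * R ^ 2 := by positivity
  have hπ := Real.pi_pos
  constructor
  · nlinarith [(abs_le.1 (h₁ R hR)).1, mul_le_mul_of_nonneg_left hI₁ hmR,
      mul_le_mul_of_nonneg_right (le_max_left A₁ A₂) hR0.le,
      mul_le_mul_of_nonneg_left hle₁ hπ.le]
  · nlinarith [(abs_le.1 (h₂ R hR)).2, mul_le_mul_of_nonneg_left hI₂ hmR,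
      mul_le_mul_of_nonneg_right (le_max_right A₁ A₂) hR0.le,
      mul_le_mul_of_nonneg_left hle₂ hπ.le]

/-- The asymptotic density statement from the end of the proof of Proposition 6.1,
item 4: if `curl j = 2π Σ_{p∈Λ} δ_p − m` in `ℝ²` and `∫_{B_R} |j| ≤ C₀ R²` for all
`R ≥ 1`, then `ν(B_R) = 2π #(Λ ∩ B_R) ∼ π m R²` as `R → ∞`; in particular
`ν(B_R)/|B_R|` is bounded for `R > 1`, so that `j ∈ 𝒜_m`. -/
theorem stmt17
    (m : ℝ) (hm : 0 < m)
    (Λ : Set E2) (hΛ : ∀ K : Set E2, IsCompact K → (Λ ∩ K).Finite)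
    (j : E2 → E2) (hj : LocallyIntegrable j volume)
    (hcurl : ∀ φ : E2 → ℝ, ContDiff ℝ (⊤ : ℕ∞) φ → HasCompactSupport φ →
      -∫ x, (-(j x 0) * fderiv ℝ φ x (EuclideanSpace.single 1 1) +
          j x 1 * fderiv ℝ φ x (EuclideanSpace.single 0 1)) =
        2 * Real.pi * (∑' q : Λ, φ q) - m * ∫ x, φ x)
    (C₀ : ℝ) (hC₀ : 0 < C₀)
    (hjbd : ∀ R : ℝ, 1 ≤ R → ∫ x in ball (0 : E2) R, ‖j x‖ ≤ C₀ * R ^ 2) :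
    Tendsto (fun R : ℝ =>
        2 * Real.pi * ((Λ ∩ ball (0 : E2) R).ncard : ℝ) / (Real.pi * m * R ^ 2))
      atTop (nhds 1) ∧
    ∃ C : ℝ, ∀ R : ℝ, 1 < R →
      2 * Real.pi * ((Λ ∩ ball (0 : E2) R).ncard : ℝ) ≤
        C * (volume (ball (0 : E2) R)).toReal := by
  have hπ := Real.pi_pos
  have hb := fun {ε : ℝ} => two_pi_ncard_inter_ball_bounds m hm Λ hΛ j hj hcurl C₀ hjbd (ε := ε)
  constructor
  · have hlim (c A : ℝ) : Tendsto (fun R : ℝ => c + A / (m * Real.pi) * R⁻¹) atTop (nhds c) := by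
      simpa using (tendsto_inv_atTop_zero.const_mul (A / (m * Real.pi))).const_add c
    have hdiv (c A R : ℝ) (hR : 1 ≤ R) :
        c + A / (m * Real.pi) * R⁻¹ =
          (m * Real.pi * c * R ^ 2 + A * R) / (Real.pi * m * R ^ 2) := by
      have : R ≠ 0 := by linarith
      field_simp
    refine tendsto_order.2 ⟨fun a ha => ?_, fun a ha => ?_⟩
    · have hcont : Tendsto (fun ε : ℝ => (1 - ε) ^ 2) (nhdsWithin 0 (Set.Ioi 0)) (nhds 1) := by
        have : Continuous fun ε : ℝ => (1 - ε) ^ 2 := by fun_prop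
        simpa using (this.tendsto 0).mono_left nhdsWithin_le_nhds
      obtain ⟨ε, hε, hε0, hε1⟩ :=
        ((hcont.eventually_const_lt ha).and (Ioo_mem_nhdsGT one_pos)).exists
      obtain ⟨A, hA⟩ := hb hε0 hε1
      filter_upwards [(hlim _ (-A)).eventually_const_lt hε, eventually_ge_atTop 1] with R hR hR1
      refine hR.trans_le ?_
      rw [hdiv _ _ _ hR1]
      gcongr
      linarith [(hA R hR1).1]
    · have hcont : Tendsto (fun ε : ℝ => (1 + ε) ^ 2) (nhdsWithin 0 (Set.Ioi 0)) (nhds 1) := by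
        have : Continuous fun ε : ℝ => (1 + ε) ^ 2 := by fun_prop
        simpa using (this.tendsto 0).mono_left nhdsWithin_le_nhds
      obtain ⟨ε, hε, hε0, hε1⟩ :=
        ((hcont.eventually_lt_const ha).and (Ioo_mem_nhdsGT one_pos)).exists
      obtain ⟨A, hA⟩ := hb hε0 hε1
      filter_upwards [(hlim _ A).eventually_lt_const hε, eventually_ge_atTop 1] with R hR hR1
      refine lt_of_le_of_lt ?_ hR
      rw [hdiv _ _ _ hR1]
      gcongr
      exact (hA R hR1).2
  · obtain ⟨A, hA⟩ := hb (ε := 1 / 2) (by norm_num) (by norm_num)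
    refine ⟨m * (1 + 1 / 2) ^ 2 + |A| / Real.pi, fun R hR => ?_⟩
    have hvol : (volume (ball (0 : E2) R)).toReal = Real.pi * R ^ 2 := by
      simp [EuclideanSpace.volume_ball_fin_two, (zero_lt_one.trans hR).le, hπ.le, mul_comm]
    have hAR : A * R ≤ |A| * R ^ 2 :=
      mul_le_mul (le_abs_self A) (by nlinarith) (by linarith) (abs_nonneg A)
    calc 2 * Real.pi * ((Λ ∩ ball (0 : E2) R).ncard : ℝ)
        ≤ m * Real.pi * (1 + 1 / 2) ^ 2 * R ^ 2 + A * R := (hA R hR.le).2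
      _ ≤ m * Real.pi * (1 + 1 / 2) ^ 2 * R ^ 2 + |A| * R ^ 2 := by gcongr
      _ = _ := by rw [hvol]; field_simp
end
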